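/- Let R := ℂ[x,y]^{μ₂} = ℂ[x²,xy,y²] and let m be the ideal of R generated by x², xy, y². Let L be the Lie subalgebra of Der_ℂ(R) generated by all locally nilpotent derivations of R. Then I := {δ ∈ L : δ(R) ⊆ m²} is a Lie ideal of L with I ≠ 0 and I ≠ L (for instance the locally nilpotent derivation induced by x³∂/∂y lies in I, while the one induced by x∂/∂y lies in L but not in I). In particular, L is not a simple Lie algebra. -/

import Mathlib

set_option synthInstance.maxHeartbeats 1000000
set_option maxHeartbeats 1600000

noncomputable section

/-- The polynomial ring `ℂ[x,y]` (variables indexed by `Fin 2`). -/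
abbrev P2 : Type := MvPolynomial (Fin 2) ℂ

/-- The invariant ring `R = ℂ[x,y]^{μ₂} = ℂ[x², xy, y²]`, i.e. the subalgebra of
`ℂ[x,y]` generated by `x²`, `xy`, `y²`. -/
def Rinv : Subalgebra ℂ P2 :=
  Algebra.adjoin ℂ {MvPolynomial.X 0 * MvPolynomial.X 0,
    MvPolynomial.X 0 * MvPolynomial.X 1, MvPolynomial.X 1 * MvPolynomial.X 1}

/-- `x²` as an element of `R`. -/
def x2 : Rinv := ⟨MvPolynomial.X 0 * MvPolynomial.X 0, Algebra.subset_adjoin (by simp)⟩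
/-- `xy` as an element of `R`. -/
def xy2 : Rinv := ⟨MvPolynomial.X 0 * MvPolynomial.X 1, Algebra.subset_adjoin (by simp)⟩
/-- `y²` as an element of `R`. -/
def y2 : Rinv := ⟨MvPolynomial.X 1 * MvPolynomial.X 1, Algebra.subset_adjoin (by simp)⟩

/-- The maximal ideal `m = (x², xy, y²)` of the singular point of `𝔸²/μ₂`. -/
def mIdeal : Ideal Rinv := Ideal.span {x2, xy2, y2}

/-- A derivation is locally nilpotent if some power of it kills each element. -/
def IsLNDR (δ : Derivation ℂ Rinv Rinv) : Prop :=
  ∀ f : Rinv, ∃ n : ℕ, 1 ≤ n ∧ (δ.toLinearMap ^ n) f = 0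

/-- The Lie subalgebra of `Der_ℂ(R)` generated by all locally nilpotent derivations. -/
def Llie : LieSubalgebra ℂ (Derivation ℂ Rinv Rinv) :=
  LieSubalgebra.lieSpan ℂ (Derivation ℂ Rinv Rinv) {δ | IsLNDR δ}

/-- Induction principle for the invariant ring. -/
theorem Rinv_induction (p : Rinv → Prop) (hx : p x2) (hxy : p xy2) (hy : p y2)
    (hc : ∀ c : ℂ, p (algebraMap ℂ Rinv c)) (ha : ∀ f g, p f → p g → p (f + g))
    (hm : ∀ f g, p f → p g → p (f * g)) (f : Rinv) : p f := by
  obtain ⟨f, hf⟩ := f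
  have hf' := hf
  unfold Rinv at hf'
  induction hf' using Algebra.adjoin_induction with
  | mem x h =>
    rcases h with rfl | rfl | rfl
    · exact hx
    · exact hxy
    · exact hy
  | algebraMap r => exact hc r
  | add a b h1 h2 i1 i2 => exact ha _ _ (i1 h1) (i2 h2)
  | mul a b h1 h2 i1 i2 => exact hm _ _ (i1 h1) (i2 h2)

theorem x2_mem : x2 ∈ mIdeal := Ideal.subset_span (by simp)
theorem xy2_mem : xy2 ∈ mIdeal := Ideal.subset_span (by simp)
theorem y2_mem : y2 ∈ mIdeal := Ideal.subset_span (by simp)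

theorem sub_const_mem (f : Rinv) :
    f - algebraMap ℂ Rinv (MvPolynomial.constantCoeff (f : P2)) ∈ mIdeal := by
  induction f using Rinv_induction with
  | hx => simpa [x2] using x2_mem
  | hxy => simpa [xy2] using xy2_mem
  | hy => simpa [y2] using y2_mem
  | hc c =>
    have : MvPolynomial.constantCoeff ((algebraMap ℂ Rinv c : Rinv) : P2) = c :=
      MvPolynomial.constantCoeff_C _ c
    rw [this, sub_self]
    exact zero_mem _
  | ha f g h1 h2 =>
    have := add_mem h1 h2
    convert this using 1
    simp only [Subalgebra.coe_add, map_add]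
    ring
  | hm f g h1 h2 =>
    have := add_mem (mIdeal.mul_mem_right g h1)
      (mIdeal.mul_mem_left (algebraMap ℂ Rinv (MvPolynomial.constantCoeff (f : P2))) h2)
    convert this using 1
    simp only [Subalgebra.coe_mul, map_mul]
    ring

theorem mem_of_const (f : Rinv) (h : MvPolynomial.constantCoeff (f : P2) = 0) :
    f ∈ mIdeal := by
  have := sub_const_mem f
  rwa [h, map_zero, sub_zero] at this

theorem coeff_aux (p q r : P2)
    (h : MvPolynomial.X 0 * MvPolynomial.X 0 * p + MvPolynomial.X 1 * MvPolynomial.X 1 * q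
      = MvPolynomial.X 0 * MvPolynomial.X 1 * r) :
    MvPolynomial.constantCoeff p = 0 ∧ MvPolynomial.constantCoeff q = 0 ∧
    MvPolynomial.constantCoeff r = 0 := by
  have e (i j : Fin 2) : (MvPolynomial.X i * MvPolynomial.X j : P2)
      = MvPolynomial.monomial (Finsupp.single i 1 + Finsupp.single j 1) 1 := by
    simp [MvPolynomial.X, MvPolynomial.monomial_mul]
  simp only [e] at h
  have h1 := congrArg (MvPolynomial.coeff (Finsupp.single 0 1 + Finsupp.single 0 1)) h
  have h2 := congrArg (MvPolynomial.coeff (Finsupp.single 1 1 + Finsupp.single 1 1)) h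
  have h3 := congrArg (MvPolynomial.coeff (Finsupp.single 0 1 + Finsupp.single 1 1)) h
  simp only [MvPolynomial.coeff_add, MvPolynomial.coeff_monomial_mul', Finsupp.le_def,
    Fin.forall_fin_two] at h1 h2 h3
  simp [MvPolynomial.constantCoeff_eq] at h1 h2 h3 ⊢
  exact ⟨h1, h2, h3.symm⟩

/-- Every derivation of `R` preserves the maximal ideal of the singular point. -/
theorem der_gen_mem (d : Derivation ℂ Rinv Rinv) :
    d x2 ∈ mIdeal ∧ d xy2 ∈ mIdeal ∧ d y2 ∈ mIdeal := by
  have rel : x2 * y2 = xy2 * xy2 := by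
    apply Subtype.ext
    simp only [x2, y2, xy2, Subalgebra.coe_mul]
    ring
  have h := congrArg d rel
  rw [d.leibniz, d.leibniz] at h
  have h' := congrArg (Subtype.val) h
  simp only [smul_eq_mul, Subalgebra.coe_add, Subalgebra.coe_mul] at h'
  have := coeff_aux (d y2 : P2) (d x2 : P2) (2 * (d xy2 : P2)) (by
    have ex : (x2 : P2) = MvPolynomial.X 0 * MvPolynomial.X 0 := rfl
    have exy : (xy2 : P2) = MvPolynomial.X 0 * MvPolynomial.X 1 := rfl
    have ey : (y2 : P2) = MvPolynomial.X 1 * MvPolynomial.X 1 := rfl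
    rw [← ex, ← exy, ← ey, h']; ring)
  obtain ⟨a, b, c⟩ := this
  refine ⟨mem_of_const _ b, mem_of_const _ ?_, mem_of_const _ a⟩
  rw [map_mul] at c
  rcases mul_eq_zero.1 c with c | c
  · have e2 : MvPolynomial.constantCoeff (2 : P2) = (2 : ℂ) := map_ofNat _ 2
    exact absurd (e2.symm.trans c) two_ne_zero
  · exact c

theorem der_mem (d : Derivation ℂ Rinv Rinv) (f : Rinv) : d f ∈ mIdeal := by
  obtain ⟨a, b, c⟩ := der_gen_mem d
  induction f using Rinv_induction with
  | hx => exact a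
  | hxy => exact b
  | hy => exact c
  | hc c => rw [d.map_algebraMap]; exact zero_mem _
  | ha f g h1 h2 => rw [map_add]; exact add_mem h1 h2
  | hm f g h1 h2 =>
    rw [d.leibniz]
    exact add_mem (mIdeal.mul_mem_left _ h2) (mIdeal.mul_mem_left _ h1)

theorem der_sq_mem (d : Derivation ℂ Rinv Rinv) (f : Rinv) (hf : f ∈ mIdeal ^ 2) :
    d f ∈ mIdeal ^ 2 := by
  rw [pow_two] at hf ⊢
  induction hf using Submodule.mul_induction_on' with
  | mem_mul_mem a ha b hb =>
    rw [d.leibniz]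
    exact add_mem (Ideal.mul_mem_mul ha (der_mem d b)) (Ideal.mul_mem_mul hb (der_mem d a))
  | add a _ b _ h1 h2 => rw [map_add]; exact add_mem h1 h2

theorem nil_mono (d : Derivation ℂ Rinv Rinv) {n m : ℕ} (h : n ≤ m) {f : Rinv}
    (hf : (d.toLinearMap ^ n) f = 0) : (d.toLinearMap ^ m) f = 0 := by
  obtain ⟨k, rfl⟩ := Nat.exists_eq_add_of_le' h
  rw [pow_add, Module.End.mul_apply, hf, map_zero]

theorem nil_mul (d : Derivation ℂ Rinv Rinv) (k : ℕ) : ∀ (n m : ℕ) (f g : Rinv), n + m ≤ k →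
    (d.toLinearMap ^ n) f = 0 → (d.toLinearMap ^ m) g = 0 →
    (d.toLinearMap ^ k) (f * g) = 0 := by
  induction k with
  | zero =>
    intro n m f g h hf hg
    obtain rfl : n = 0 := by omega
    have : f = 0 := by simpa using hf
    simp [this]
  | succ k ih =>
    intro n m f g h hf hg
    rcases n with _ | n
    · have : f = 0 := by simpa using hf
      rw [this, zero_mul, map_zero]
    rcases m with _ | m
    · have : g = 0 := by simpa using hg
      rw [this, mul_zero, map_zero]
    rw [pow_succ, Module.End.mul_apply]
    have e : d.toLinearMap (f * g) = f * d g + g * d f := d.leibniz f g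
    rw [e, map_add, ih (n + 1) m f (d g) (by omega) hf
      (by rw [pow_succ, Module.End.mul_apply] at hg; exact hg),
      ih (m + 1) n g (d f) (by omega) hg
      (by rw [pow_succ, Module.End.mul_apply] at hf; exact hf), add_zero]

theorem lnd_of_gen (d : Derivation ℂ Rinv Rinv) (n : ℕ) (h1 : (d.toLinearMap ^ n) x2 = 0)
    (h2 : (d.toLinearMap ^ n) xy2 = 0) (h3 : (d.toLinearMap ^ n) y2 = 0) : IsLNDR d := by
  intro f
  suffices h : ∃ n : ℕ, (d.toLinearMap ^ n) f = 0 by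
    obtain ⟨n, hn⟩ := h
    exact ⟨n + 1, by omega, nil_mono d (Nat.le_succ n) hn⟩
  induction f using Rinv_induction with
  | hx => exact ⟨n, h1⟩
  | hxy => exact ⟨n, h2⟩
  | hy => exact ⟨n, h3⟩
  | hc c => exact ⟨1, by rw [pow_one]; exact d.map_algebraMap c⟩
  | ha f g h1 h2 =>
    obtain ⟨a, ha⟩ := h1
    obtain ⟨b, hb⟩ := h2
    exact ⟨a + b, by rw [map_add, nil_mono d (Nat.le_add_right a b) ha,
      nil_mono d (Nat.le_add_left b a) hb, add_zero]⟩
  | hm f g h1 h2 =>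
    obtain ⟨a, ha⟩ := h1
    obtain ⟨b, hb⟩ := h2
    exact ⟨a + b, nil_mul d _ a b f g le_rfl ha hb⟩

theorem lnd_tri (d : Derivation ℂ Rinv Rinv) (r : Rinv) (hr : d r = 0) (h1 : d x2 = 0)
    (h2 : d xy2 = r * x2) (h3 : d y2 = 2 * (r * xy2)) : IsLNDR d := by
  have hrx : d (r * x2) = 0 := by rw [d.leibniz, hr, h1]; simp
  have h22 : d (2 : Rinv) = 0 := d.map_natCast 2
  have h32 : d (2 * (r * xy2)) = 2 * (r * (r * x2)) := by
    rw [d.leibniz, d.leibniz, hr, h2, h22]; simp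
  have h33 : d (2 * (r * (r * x2))) = 0 := by
    rw [d.leibniz, d.leibniz, hr, hrx, h22]; simp
  have e (f : Rinv) : (d.toLinearMap ^ 3) f = d (d (d f)) := rfl
  refine lnd_of_gen d 3 ?_ ?_ ?_
  · rw [e, h1, map_zero, map_zero]
  · rw [e, h2, hrx, map_zero]
  · rw [e, h3, h32, h33]

theorem x2_not_mem : x2 ∉ mIdeal ^ 2 := by
  let φ : Rinv →+* Polynomial ℂ :=
    ((MvPolynomial.aeval ![Polynomial.X, 0] : P2 →ₐ[ℂ] Polynomial ℂ).comp Rinv.val).toRingHom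
  have e1 : φ x2 = Polynomial.X ^ 2 := by simp [φ, x2, pow_two]
  have e2 : φ xy2 = 0 := by simp [φ, xy2]
  have e3 : φ y2 = 0 := by simp [φ, y2]
  have hle : mIdeal ≤ (Ideal.span {(Polynomial.X ^ 2 : Polynomial ℂ)}).comap φ := by
    unfold mIdeal
    rw [Ideal.span_le]
    rintro f (rfl | rfl | rfl)
    · simp only [SetLike.mem_coe, Ideal.mem_comap, e1]
      exact Ideal.subset_span rfl
    · simp only [SetLike.mem_coe, Ideal.mem_comap, e2]
      exact zero_mem _
    · simp only [SetLike.mem_coe, Ideal.mem_comap, e3]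
      exact zero_mem _
  intro h
  have h' := (Ideal.pow_right_mono hle 2).trans (Ideal.le_comap_pow φ 2) h
  rw [Ideal.mem_comap, e1, Ideal.span_singleton_pow, Ideal.mem_span_singleton, ← pow_mul,
    Polynomial.X_pow_dvd_iff] at h'
  simpa using h' 2 (by norm_num)

theorem x2_sq_ne : x2 * x2 ≠ 0 := by
  have : x2 ≠ 0 := fun h => x2_not_mem (h ▸ zero_mem _)
  exact mul_ne_zero this this

/-- The Lie ideal of derivations in `L` mapping `R` into `m²`. -/
def theIdeal : LieIdeal ℂ Llie where
  carrier := {d | ∀ f : Rinv, (d : Derivation ℂ Rinv Rinv) f ∈ mIdeal ^ 2}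
  add_mem' := fun h1 h2 f => add_mem (h1 f) (h2 f)
  zero_mem' := fun _ => zero_mem _
  smul_mem' := fun c d h f => by
    have e : ((c • d : Llie) : Derivation ℂ Rinv Rinv) f
      = algebraMap ℂ Rinv c * (d : Derivation ℂ Rinv Rinv) f := Algebra.smul_def c _
    rw [e]
    exact Ideal.mul_mem_left _ _ (h f)
  lie_mem := fun {x d} h f => by
    have e : ((⁅x, d⁆ : Llie) : Derivation ℂ Rinv Rinv) f
      = (x : Derivation ℂ Rinv Rinv) ((d : Derivation ℂ Rinv Rinv) f)
        - (d : Derivation ℂ Rinv Rinv) ((x : Derivation ℂ Rinv Rinv) f) :=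
      Derivation.commutator_apply f
    rw [e]
    exact sub_mem (der_sq_mem _ _ (h f)) (h _)

/-- With `L` the Lie algebra generated by the locally nilpotent derivations of
`R = ℂ[x,y]^{μ₂}`: the set `{δ ∈ L : δ(R) ⊆ m²}` is a Lie ideal of `L`, nonzero and
proper.  Witnesses: any derivation `d₃` induced by `x³∂/∂y` (so `d₃(x²) = 0`,
`d₃(xy) = x⁴`, `d₃(y²) = 2x²·xy`) is locally nilpotent, lies in `L` and maps `R`
into `m²`, while any derivation `d₁` induced by `x∂/∂y` (so `d₁(x²) = 0`,
`d₁(xy) = x²`, `d₁(y²) = 2xy`) is locally nilpotent, lies in `L` and does not map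
`R` into `m²`.  In particular `L` is not a simple Lie algebra. -/
theorem lnd_span_not_simple
    (d3 : Derivation ℂ Rinv Rinv)
    (hd3 : d3 x2 = 0 ∧ d3 xy2 = x2 * x2 ∧ d3 y2 = 2 * (x2 * xy2))
    (d1 : Derivation ℂ Rinv Rinv)
    (hd1 : d1 x2 = 0 ∧ d1 xy2 = x2 ∧ d1 y2 = 2 * xy2) :
    (∃ I : LieIdeal ℂ Llie,
        (∀ d : Llie, d ∈ I ↔ ∀ f : Rinv, (d : Derivation ℂ Rinv Rinv) f ∈ mIdeal ^ 2) ∧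
        I ≠ ⊥ ∧ I ≠ ⊤) ∧
    (IsLNDR d3 ∧ d3 ∈ Llie ∧ (∀ f : Rinv, d3 f ∈ mIdeal ^ 2)) ∧
    (IsLNDR d1 ∧ d1 ∈ Llie ∧ ¬ (∀ f : Rinv, d1 f ∈ mIdeal ^ 2)) ∧
    ¬ (∀ I : LieIdeal ℂ Llie, I = ⊥ ∨ I = ⊤) := by
  obtain ⟨a1, a2, a3⟩ := hd3
  obtain ⟨b1, b2, b3⟩ := hd1
  have L3 : IsLNDR d3 := lnd_tri d3 x2 a1 a1 a2 a3
  have L1 : IsLNDR d1 := lnd_tri d1 1 d1.map_one_eq_zero b1 (by rw [b2, one_mul])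
    (by rw [b3, one_mul])
  have M3 : d3 ∈ Llie := LieSubalgebra.subset_lieSpan L3
  have M1 : d1 ∈ Llie := LieSubalgebra.subset_lieSpan L1
  have S3 : ∀ f : Rinv, d3 f ∈ mIdeal ^ 2 := by
    intro f
    induction f using Rinv_induction with
    | hx => rw [a1]; exact zero_mem _
    | hxy => rw [a2, pow_two]; exact Ideal.mul_mem_mul x2_mem x2_mem
    | hy =>
      rw [a3, pow_two]
      exact Ideal.mul_mem_left _ _ (Ideal.mul_mem_mul x2_mem xy2_mem)
    | hc c => rw [d3.map_algebraMap]; exact zero_mem _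
    | ha f g h1 h2 => rw [map_add]; exact add_mem h1 h2
    | hm f g h1 h2 =>
      rw [d3.leibniz]
      exact add_mem (Ideal.mul_mem_left _ _ h2) (Ideal.mul_mem_left _ _ h1)
  have S1 : ¬ ∀ f : Rinv, d1 f ∈ mIdeal ^ 2 := fun h => x2_not_mem (b2 ▸ h xy2)
  have hb : theIdeal ≠ ⊥ := by
    intro h
    have hm : (⟨d3, M3⟩ : Llie) ∈ theIdeal := S3
    rw [h, LieSubmodule.mem_bot] at hm
    have h0 : d3 = 0 := congrArg Subtype.val hm
    apply x2_sq_ne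
    rw [← a2, h0]
    rfl
  have ht : theIdeal ≠ ⊤ := by
    intro h
    have hm : (⟨d1, M1⟩ : Llie) ∈ theIdeal := h ▸ LieSubmodule.mem_top _
    exact S1 hm
  exact ⟨⟨theIdeal, fun d => Iff.rfl, hb, ht⟩, ⟨L3, M3, S3⟩, ⟨L1, M1, S1⟩,
    fun h => (h theIdeal).elim hb ht⟩

end
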